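/- Let A ⊂ ℝ² be measurable with no three points of A having all pairwise distances greater than 2, and suppose λ₂(A) = 2π. Then A is, up to a λ₂-null set, a union of two non-overlapping unit disks. -/

import Mathlib

open MeasureTheory

/-- The Euclidean plane. -/
abbrev Plane := EuclideanSpace ℝ (Fin 2)

/-- The integral of `√(d² - s²)` over `[0, w]`. -/
noncomputable def semichordIntegral (d w : ℝ) : ℝ := ∫ s in (0 : ℝ)..w, √(d ^ 2 - s ^ 2)

lemma continuous_semichord (d : ℝ) : Continuous fun s : ℝ => √(d ^ 2 - s ^ 2) := by fun_prop

lemma semichordIntegral_mono (d : ℝ) : Monotone (semichordIntegral d) := by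
  intro a b hab
  unfold semichordIntegral
  rw [← intervalIntegral.integral_add_adjacent_intervals (a := 0) (b := a) (c := b)
    ((continuous_semichord d).intervalIntegrable _ _)
    ((continuous_semichord d).intervalIntegrable _ _)]
  have : 0 ≤ ∫ s in a..b, √(d ^ 2 - s ^ 2) :=
    intervalIntegral.integral_nonneg hab fun s _ => Real.sqrt_nonneg _
  linarith

lemma hasDerivAt_semichordIntegral (d w : ℝ) :
    HasDerivAt (semichordIntegral d) √(d ^ 2 - w ^ 2) w :=
  intervalIntegral.integral_hasDerivAt_right ((continuous_semichord d).intervalIntegrable _ _)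
    ((continuous_semichord d).stronglyMeasurableAtFilter _ _)
    (continuous_semichord d).continuousAt

lemma strictConcaveOn_semichordIntegral :
    StrictConcaveOn ℝ (Set.Icc 0 2) (semichordIntegral 2) := by
  apply StrictAntiOn.strictConcaveOn_of_deriv (convex_Icc 0 2)
  · exact fun x _ => (hasDerivAt_semichordIntegral 2 x).continuousAt.continuousWithinAt
  · rw [interior_Icc]
    intro a ha b hb hab
    rw [(hasDerivAt_semichordIntegral 2 a).deriv, (hasDerivAt_semichordIntegral 2 b).deriv]
    apply Real.sqrt_lt_sqrt
    · nlinarith [hb.1, hb.2]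
    · nlinarith [ha.1, hb.1]

lemma strictMonoOn_semichordIntegral :
    StrictMonoOn (semichordIntegral 2) (Set.Icc 0 2) := by
  apply strictMonoOn_of_deriv_pos (convex_Icc 0 2)
  · exact fun x _ => (hasDerivAt_semichordIntegral 2 x).continuousAt.continuousWithinAt
  · rw [interior_Icc]
    intro a ha
    rw [(hasDerivAt_semichordIntegral 2 a).deriv]
    apply Real.sqrt_pos.2
    nlinarith [ha.1, ha.2]

lemma integral_semichord_neg (d a : ℝ) :
    ∫ s in -a..a, √(d ^ 2 - s ^ 2) = 2 * semichordIntegral d a := by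
  rw [← intervalIntegral.integral_add_adjacent_intervals (a := -a) (b := 0) (c := a)
    ((continuous_semichord d).intervalIntegrable _ _)
    ((continuous_semichord d).intervalIntegrable _ _)]
  have h := intervalIntegral.integral_comp_neg (a := 0) (b := a)
    (fun s : ℝ => √(d ^ 2 - s ^ 2))
  simp only [neg_sq, neg_zero] at h
  rw [← h, semichordIntegral]
  ring

lemma semichordIntegral_self {d : ℝ} (hd : 0 ≤ d) :
    semichordIntegral d d = Real.pi * d ^ 2 / 4 := by
  rcases hd.eq_or_lt with rfl | hd
  · simp [semichordIntegral]
  have h1 := integral_semichord_neg d d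
  have h2 := intervalIntegral.integral_comp_mul_left (a := -1) (b := 1)
    (fun s : ℝ => √(d ^ 2 - s ^ 2)) hd.ne'
  have h3 : ∀ x : ℝ, √(d ^ 2 - (d * x) ^ 2) = d * √(1 - x ^ 2) := fun x => by
    rw [show d ^ 2 - (d * x) ^ 2 = d ^ 2 * (1 - x ^ 2) by ring, Real.sqrt_mul (sq_nonneg d),
      Real.sqrt_sq hd.le]
  simp only [h3, intervalIntegral.integral_const_mul, integral_sqrt_one_sub_sq, mul_neg, mul_one,
    h1, smul_eq_mul] at h2
  field_simp at h2
  linarith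

lemma semichordIntegral_le_self {d : ℝ} (hd : 0 ≤ d) (w : ℝ) :
    semichordIntegral d w ≤ Real.pi * d ^ 2 / 4 := by
  rw [← semichordIntegral_self hd]
  rcases le_total w d with h | h
  · exact semichordIntegral_mono d h
  · unfold semichordIntegral
    rw [← intervalIntegral.integral_add_adjacent_intervals (a := 0) (b := d) (c := w)
      ((continuous_semichord d).intervalIntegrable _ _)
      ((continuous_semichord d).intervalIntegrable _ _)]
    have : ∫ s in d..w, √(d ^ 2 - s ^ 2) = 0 := by
      rw [intervalIntegral.integral_congr (g := fun _ => (0 : ℝ))]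
      · simp
      · intro s hs
        rw [Set.uIcc_of_le h] at hs
        exact Real.sqrt_eq_zero_of_nonpos (by nlinarith [hs.1])
    linarith

lemma volume_eq_lintegral_slice {S : Set Plane} (hS : MeasurableSet S) :
    volume S = ∫⁻ t : ℝ, volume {r : ℝ | !₂[r, t] ∈ S} := by
  have h1 := (PiLp.volume_preserving_toLp (Fin 2)).measure_preimage hS.nullMeasurableSet
  have hS' : MeasurableSet (WithLp.toLp 2 ⁻¹' S : Set (Fin 2 → ℝ)) :=
    (PiLp.volume_preserving_toLp (Fin 2)).measurable hS
  have h2 := (volume_preserving_finTwoArrow ℝ).symm.measure_preimage hS'.nullMeasurableSet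
  rw [← h1, ← h2, Measure.volume_eq_prod, Measure.prod_apply_symm]
  · rfl
  · exact (volume_preserving_finTwoArrow ℝ).symm.measurable hS'

lemma volume_add_volume_le {I J : Set ℝ} {ρ : ℝ} (hI : I.Nonempty) (hJ : J.Nonempty)
    (h : ∀ a ∈ I, ∀ b ∈ J, |a - b| ≤ ρ) :
    volume I + volume J ≤ ENNReal.ofReal ((sSup I - sInf J) + (sSup J - sInf I)) := by
  obtain ⟨i, hi⟩ := hI
  obtain ⟨j, hj⟩ := hJ
  have hIa : BddAbove I := ⟨j + ρ, fun a ha => by linarith [(abs_le.1 (h a ha j hj)).2]⟩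
  have hIb : BddBelow I := ⟨j - ρ, fun a ha => by linarith [(abs_le.1 (h a ha j hj)).1]⟩
  have hJa : BddAbove J := ⟨i + ρ, fun b hb => by linarith [(abs_le.1 (h i hi b hb)).1]⟩
  have hJb : BddBelow J := ⟨i - ρ, fun b hb => by linarith [(abs_le.1 (h i hi b hb)).2]⟩
  have h1 : volume I ≤ ENNReal.ofReal (sSup I - sInf I) := by
    rw [← Real.volume_Icc]
    exact measure_mono fun a ha => ⟨csInf_le hIb ha, le_csSup hIa ha⟩
  have h2 : volume J ≤ ENNReal.ofReal (sSup J - sInf J) := by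
    rw [← Real.volume_Icc]
    exact measure_mono fun a ha => ⟨csInf_le hJb ha, le_csSup hJa ha⟩
  refine (add_le_add h1 h2).trans ?_
  rw [← ENNReal.ofReal_add]
  · exact ENNReal.ofReal_le_ofReal (by linarith)
  · linarith [csInf_le hIb hi, le_csSup hIa hi]
  · linarith [csInf_le hJb hj, le_csSup hJa hj]

/-- The horizontal slice of a planar set at height `t`. -/
def slice (K : Set Plane) (t : ℝ) : Set ℝ := {r : ℝ | !₂[r, t] ∈ K}

lemma dist_sq_eq (p q : Plane) : dist p q ^ 2 = (p 0 - q 0) ^ 2 + (p 1 - q 1) ^ 2 := by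
  rw [dist_eq_norm, EuclideanSpace.real_norm_sq_eq, Fin.sum_univ_two]
  rfl

lemma norm_sq_eq_plane (p : Plane) : ‖p‖ ^ 2 = p 0 ^ 2 + p 1 ^ 2 := by
  rw [EuclideanSpace.real_norm_sq_eq, Fin.sum_univ_two]

lemma mem_slice_apply {K : Set Plane} {p : Plane} (hp : p ∈ K) : p 0 ∈ slice K (p 1) := by
  have : !₂[p 0, p 1] = p := by ext i; fin_cases i <;> rfl
  simpa [slice, this] using hp

lemma abs_sub_le_of_mem_slice {K : Set Plane} {d t t' r r' : ℝ}
    (hK : ∀ p ∈ K, ∀ q ∈ K, dist p q ≤ d) (hr : r ∈ slice K t) (hr' : r' ∈ slice K t') :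
    |r - r'| ≤ √(d ^ 2 - (t - t') ^ 2) := by
  apply Real.abs_le_sqrt
  have h1 := hK _ hr _ hr'
  have h2 := dist_sq_eq !₂[r, t] !₂[r', t']
  simp only [Matrix.cons_val_zero, Matrix.cons_val_one] at h2
  nlinarith [dist_nonneg (x := !₂[r, t]) (y := !₂[r', t'])]

lemma measurable_volume_slice {K : Set Plane} (hK : MeasurableSet K) :
    Measurable fun t => volume (slice K t) := by
  have hK' : MeasurableSet (WithLp.toLp 2 ⁻¹' K : Set (Fin 2 → ℝ)) :=
    (PiLp.volume_preserving_toLp (Fin 2)).measurable hK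
  exact measurable_measure_prodMk_right ((volume_preserving_finTwoArrow ℝ).symm.measurable hK')

lemma two_mul_volume_eq_lintegral {K : Set Plane} (hK : MeasurableSet K) {a b : ℝ}
    (h : ∀ p ∈ K, p 1 ∈ Set.Icc a b) :
    2 * volume K = ∫⁻ t in Set.Icc a b, (volume (slice K t) + volume (slice K (a + b - t))) := by
  have hout : ∀ t, t ∉ Set.Icc a b → slice K t = ∅ := fun t ht =>
    Set.eq_empty_of_forall_notMem fun r hr => ht (h _ hr)
  have h1 : volume K = ∫⁻ t, volume (slice K t) := volume_eq_lintegral_slice hK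
  have h2 : volume K = ∫⁻ t, volume (slice K (a + b - t)) := by
    rw [h1, lintegral_sub_left_eq_self (fun t => volume (slice K t)) (a + b)]
  rw [two_mul]
  nth_rewrite 1 [h1]
  rw [h2, ← lintegral_add_left (measurable_volume_slice hK)]
  refine (setLIntegral_eq_of_support_subset ?_).symm
  intro t ht
  by_contra hn
  apply ht
  have hn' : a + b - t ∉ Set.Icc a b := fun hm => hn ⟨by linarith [hm.2], by linarith [hm.1]⟩
  simp [hout t hn, hout _ hn']

lemma lintegral_chord_eq (d : ℝ) {a b : ℝ} (hab : a ≤ b) :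
    ∫⁻ t in Set.Icc a b, ENNReal.ofReal (2 * √(d ^ 2 - (t - (a + b - t)) ^ 2)) =
      ENNReal.ofReal (2 * semichordIntegral d (b - a)) := by
  have hc : Continuous fun t : ℝ => 2 * √(d ^ 2 - (t - (a + b - t)) ^ 2) := by fun_prop
  rw [← ofReal_integral_eq_lintegral_ofReal (hc.integrableOn_Icc)
    (Filter.Eventually.of_forall fun t => by positivity), integral_Icc_eq_integral_Ioc,
    ← intervalIntegral.integral_of_le hab]
  congr 1
  rw [intervalIntegral.integral_const_mul]
  have h := intervalIntegral.integral_comp_mul_sub (a := a) (b := b)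
    (fun s : ℝ => √(d ^ 2 - s ^ 2)) (two_ne_zero) (a + b)
  rw [show 2 * a - (a + b) = -(b - a) by ring, show 2 * b - (a + b) = b - a by ring,
    integral_semichord_neg] at h
  have h' : ∀ t : ℝ, t - (a + b - t) = 2 * t - (a + b) := fun t => by ring
  simp only [h', h, smul_eq_mul]
  ring

lemma volume_slice_add_le {K : Set Plane} {d a b t : ℝ}
    (hd : ∀ p ∈ K, ∀ q ∈ K, dist p q ≤ d)
    (hne : ∀ t ∈ Set.Icc a b, (slice K t).Nonempty) (ht : t ∈ Set.Icc a b) :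
    volume (slice K t) + volume (slice K (a + b - t)) ≤
      ENNReal.ofReal (2 * √(d ^ 2 - (t - (a + b - t)) ^ 2)) := by
  have ht' : a + b - t ∈ Set.Icc a b := ⟨by linarith [ht.2], by linarith [ht.1]⟩
  have hI := hne t ht
  have hJ := hne _ ht'
  have hIJ : ∀ r ∈ slice K t, ∀ r' ∈ slice K (a + b - t), |r - r'| ≤ _ :=
    fun r hr r' hr' => abs_sub_le_of_mem_slice hd hr hr'
  refine (volume_add_volume_le hI hJ hIJ).trans (ENNReal.ofReal_le_ofReal ?_)
  have h1 : sSup (slice K t) ≤ sInf (slice K (a + b - t)) + √(d ^ 2 - (t - (a + b - t)) ^ 2) := by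
    refine csSup_le hI fun r hr => ?_
    rw [← sub_le_iff_le_add]
    exact le_csInf hJ fun r' hr' => by linarith [(abs_le.1 (hIJ r hr r' hr')).2]
  have h2 : sSup (slice K (a + b - t)) ≤ sInf (slice K t) + √(d ^ 2 - (t - (a + b - t)) ^ 2) := by
    refine csSup_le hJ fun r hr => ?_
    rw [← sub_le_iff_le_add]
    exact le_csInf hI fun r' hr' => by linarith [(abs_le.1 (hIJ r' hr' r hr)).1]
  linarith

/-- A compact convex set attains all heights between its extreme heights. -/
lemma exists_height_range {K : Set Plane} (hc : IsCompact K) (hv : Convex ℝ K)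
    (hne : K.Nonempty) :
    ∃ p ∈ K, ∃ q ∈ K, (∀ z ∈ K, z 1 ∈ Set.Icc (p 1) (q 1)) ∧
      ∀ t ∈ Set.Icc (p 1) (q 1), (slice K t).Nonempty := by
  have hcont : Continuous fun z : Plane => z 1 := by fun_prop
  obtain ⟨p, hp, hp'⟩ := hc.exists_isMinOn hne hcont.continuousOn
  obtain ⟨q, hq, hq'⟩ := hc.exists_isMaxOn hne hcont.continuousOn
  refine ⟨p, hp, q, hq, fun z hz => ⟨hp' hz, hq' hz⟩, fun t ht => ?_⟩
  obtain ⟨z, hz, rfl⟩ := (hv.isPreconnected.image _ hcont.continuousOn).Icc_subset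
    (Set.mem_image_of_mem _ hp) (Set.mem_image_of_mem _ hq) ht
  exact ⟨_, mem_slice_apply hz⟩

lemma volume_le_of_ediam_of_strip {K : Set Plane} (hc : IsCompact K) (hv : Convex ℝ K) {d a b : ℝ}
    (hd : ∀ p ∈ K, ∀ q ∈ K, dist p q ≤ d) (h : ∀ p ∈ K, p 1 ∈ Set.Icc a b) :
    volume K ≤ ENNReal.ofReal (semichordIntegral d (b - a)) := by
  rcases K.eq_empty_or_nonempty with rfl | hne
  · simp
  obtain ⟨p, hp, q, hq, hpq, hsl⟩ := exists_height_range hc hv hne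
  have h2 : 2 * volume K ≤ 2 * ENNReal.ofReal (semichordIntegral d (b - a)) := by
    rw [two_mul_volume_eq_lintegral hc.measurableSet hpq]
    calc _ ≤ ∫⁻ t in Set.Icc (p 1) (q 1),
            ENNReal.ofReal (2 * √(d ^ 2 - (t - (p 1 + q 1 - t)) ^ 2)) :=
          setLIntegral_mono' measurableSet_Icc fun t ht => volume_slice_add_le hd hsl ht
      _ = ENNReal.ofReal (2 * semichordIntegral d (q 1 - p 1)) := lintegral_chord_eq d (hpq p hp).2
      _ ≤ _ := by
          rw [ENNReal.ofReal_mul zero_le_two, ENNReal.ofReal_ofNat]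
          gcongr
          exact semichordIntegral_mono d (by linarith [(h p hp).1, (h q hq).2])
  exact (ENNReal.mul_le_mul_iff_right two_ne_zero ENNReal.ofNat_ne_top).1 h2

/-- The isodiametric inequality for compact convex planar sets. -/
lemma volume_le_of_dist_le {K : Set Plane} (hc : IsCompact K) (hv : Convex ℝ K) {d : ℝ}
    (hd0 : 0 ≤ d) (hd : ∀ p ∈ K, ∀ q ∈ K, dist p q ≤ d) :
    volume K ≤ ENNReal.ofReal (Real.pi * d ^ 2 / 4) := by
  rcases K.eq_empty_or_nonempty with rfl | hne
  · simp
  obtain ⟨p, hp, q, hq, hpq, -⟩ := exists_height_range hc hv hne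
  exact (volume_le_of_ediam_of_strip hc hv hd hpq).trans
    (ENNReal.ofReal_le_ofReal (semichordIntegral_le_self hd0 _))

lemma eq_of_parallel_diametral {K : Set Plane} (hd : ∀ p ∈ K, ∀ q ∈ K, dist p q ≤ 2)
    {p q p' q' : Plane} (hp : p ∈ K) (hq : q ∈ K) (hp' : p' ∈ K) (hq' : q' ∈ K)
    (hpq : dist p q = 2) (h : p - q = p' - q') : p = p' := by
  have h0 : p 0 - q 0 = p' 0 - q' 0 := congrArg (fun z : Plane => z 0) h
  have h1 : p 1 - q 1 = p' 1 - q' 1 := congrArg (fun z : Plane => z 1) h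
  have e1 := hd p hp q' hq'
  have e2 := hd p' hp' q hq
  have d0 := dist_sq_eq p q
  have d1 := dist_sq_eq p q'
  have d2 := dist_sq_eq p' q
  have d3 := dist_sq_eq p p'
  rw [hpq] at d0
  have n1 : dist p q' ^ 2 ≤ 2 ^ 2 := by gcongr
  have n2 : dist p' q ^ 2 ≤ 2 ^ 2 := by gcongr
  have hq0 : q' 0 = p' 0 - p 0 + q 0 := by linarith
  have hq1 : q' 1 = p' 1 - p 1 + q 1 := by linarith
  rw [hq0, hq1] at d1
  have : dist p p' ^ 2 ≤ 0 := by nlinarith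
  exact dist_eq_zero.1 (pow_eq_zero_iff two_ne_zero |>.1 (le_antisymm this (sq_nonneg _)))

lemma isCompact_slice {K : Set Plane} (hc : IsCompact K) (t : ℝ) : IsCompact (slice K t) := by
  have hcl : IsClosed (slice K t) :=
    hc.isClosed.preimage (f := fun r : ℝ => !₂[r, t]) (by fun_prop)
  refine (hc.image (f := fun z : Plane => z 0) (by fun_prop)).of_isClosed_subset hcl ?_
  intro r hr
  exact ⟨_, hr, rfl⟩

lemma exists_diametral_of_height {K : Set Plane} (hc : IsCompact K) (hv : Convex ℝ K)
    (hd : ∀ p ∈ K, ∀ q ∈ K, dist p q ≤ 2) (hvol : ENNReal.ofReal Real.pi ≤ volume K) :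
    ∃ σ : ℝ, ∀ s ∈ Set.Icc (-1 : ℝ) 1, ∃ p ∈ K, ∃ q ∈ K,
      p 1 + q 1 = σ ∧ p 1 - q 1 = 2 * s ∧ p 0 - q 0 = √(2 ^ 2 - (2 * s) ^ 2) := by
  rcases K.eq_empty_or_nonempty with rfl | hne
  · simp [Real.pi_pos.not_ge] at hvol
  obtain ⟨p, hp, q, hq, hpq, hsl⟩ := exists_height_range hc hv hne
  set a := p 1
  set b := q 1
  have hab : a ≤ b := (hpq p hp).2
  have hw : b - a ≤ 2 := by
    have h1 := dist_sq_eq q p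
    have h2 := hd q hq p hp
    have h3 : dist q p ^ 2 ≤ 2 ^ 2 := by gcongr
    nlinarith [sq_nonneg (q 0 - p 0)]
  have hJ2 : semichordIntegral 2 2 = Real.pi := by
    rw [semichordIntegral_self zero_le_two]; ring
  have hbound := volume_le_of_ediam_of_strip hc hv hd hpq
  have hw2 : b - a = 2 := by
    have h1 := hvol.trans hbound
    by_contra hne
    have h2 := strictMonoOn_semichordIntegral ⟨sub_nonneg.2 hab, hw⟩
      (Set.right_mem_Icc.2 zero_le_two) (lt_of_le_of_ne hw hne)
    rw [hJ2] at h2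
    exact absurd h1 (not_le.2 ((ENNReal.ofReal_lt_ofReal_iff Real.pi_pos).2 h2))
  have hae : ∀ᵐ t ∂volume.restrict (Set.Icc a b),
      volume (slice K t) + volume (slice K (a + b - t)) =
        ENNReal.ofReal (2 * √(2 ^ 2 - (t - (a + b - t)) ^ 2)) := by
    refine ae_eq_of_ae_le_of_lintegral_le ?_ ?_ (by fun_prop) ?_
    · exact (ae_restrict_iff' measurableSet_Icc).2 <| .of_forall fun t ht =>
        volume_slice_add_le hd hsl ht
    · rw [← two_mul_volume_eq_lintegral hc.measurableSet hpq]
      exact ENNReal.mul_ne_top ENNReal.ofNat_ne_top hc.measure_lt_top.ne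
    · rw [lintegral_chord_eq 2 hab, ← two_mul_volume_eq_lintegral hc.measurableSet hpq, hw2, hJ2,
        ENNReal.ofReal_mul zero_le_two, ENNReal.ofReal_ofNat]
      gcongr
  let G : Set (Plane × Plane) := (K ×ˢ K) ∩ {z | z.1 1 + z.2 1 = a + b ∧
    z.1 0 - z.2 0 = √(2 ^ 2 - (z.1 1 - z.2 1) ^ 2)}
  have hG : IsCompact G := by
    refine (hc.prod hc).inter_right (IsClosed.inter ?_ ?_)
    · exact isClosed_eq (by fun_prop) (by fun_prop)
    · exact isClosed_eq (by fun_prop) (by fun_prop)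
  let Z : Set ℝ := (fun z : Plane × Plane => z.1 1) '' G
  have hZ : IsClosed Z := (hG.image (by fun_prop)).isClosed
  have hgood : ∀ t ∈ Set.Icc a b, volume (slice K t) + volume (slice K (a + b - t)) =
        ENNReal.ofReal (2 * √(2 ^ 2 - (t - (a + b - t)) ^ 2)) → t ∈ Z := by
    intro t ht heq
    have ht' : a + b - t ∈ Set.Icc a b := ⟨by linarith [ht.2], by linarith [ht.1]⟩
    have hI := hsl t ht
    have hJ := hsl _ ht'
    have hIJ : ∀ r ∈ slice K t, ∀ r' ∈ slice K (a + b - t), |r - r'| ≤ _ :=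
      fun r hr r' hr' => abs_sub_le_of_mem_slice hd hr hr'
    have h := volume_add_volume_le hI hJ hIJ
    have m1 := (isCompact_slice hc t).sSup_mem hI
    have m2 := (isCompact_slice hc t).sInf_mem hI
    have m3 := (isCompact_slice hc (a + b - t)).sSup_mem hJ
    have m4 := (isCompact_slice hc (a + b - t)).sInf_mem hJ
    have b1 := (abs_le.1 (hIJ _ m1 _ m4)).2
    have b2 := (abs_le.1 (hIJ _ m2 _ m3)).1
    have n1 := csInf_le (isCompact_slice hc t).bddBelow m1
    have n2 := csInf_le (isCompact_slice hc (a + b - t)).bddBelow m3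
    rw [heq, ENNReal.ofReal_le_ofReal_iff (by linarith)] at h
    exact ⟨(!₂[_, t], !₂[_, a + b - t]), ⟨⟨m1, m4⟩, by simp, by
      simp only [Matrix.cons_val_zero, Matrix.cons_val_one]
      linarith⟩, rfl⟩
  have hempty : Set.Ioo a b ∩ Zᶜ = ∅ := by
    refine (isOpen_Ioo.inter hZ.isOpen_compl).eq_empty_of_measure_zero (μ := volume) ?_
    rw [ae_restrict_iff' measurableSet_Icc] at hae
    refine measure_mono_null ?_ hae
    exact fun t ht h => ht.2 (hgood t (Set.Ioo_subset_Icc_self ht.1)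
      (h (Set.Ioo_subset_Icc_self ht.1)))
  have hIoo : Set.Ioo a b ⊆ Z := fun t ht => by
    by_contra h
    exact (hempty ▸ (⟨ht, h⟩ : t ∈ Set.Ioo a b ∩ Zᶜ) : t ∈ (∅ : Set ℝ))
  have hIcc : Set.Icc a b ⊆ Z := by
    rw [← closure_Ioo (by linarith : a ≠ b)]
    exact closure_minimal hIoo hZ
  refine ⟨a + b, fun s hs => ?_⟩
  obtain ⟨⟨u, v⟩, ⟨⟨hu, hv⟩, huv, huv'⟩, hut⟩ := hIcc
    (show s + (a + b) / 2 ∈ Set.Icc a b from ⟨by linarith [hs.1], by linarith [hs.2]⟩)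
  simp only at huv huv' hut
  have hs2 : u 1 - v 1 = 2 * s := by linarith
  exact ⟨u, hu, v, hv, huv, hs2, by rw [huv', hs2]⟩

lemma exists_diametral {K : Set Plane} (hc : IsCompact K) (hv : Convex ℝ K)
    (hd : ∀ p ∈ K, ∀ q ∈ K, dist p q ≤ 2) (hvol : ENNReal.ofReal Real.pi ≤ volume K) :
    ∃ σ : ℝ, (∀ p ∈ K, ∀ q ∈ K, dist p q = 2 → p 1 + q 1 = σ) ∧
      ∀ f : Plane, ‖f‖ = 1 → ∃ p ∈ K, ∃ q ∈ K, p - q = (2 : ℝ) • f := by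
  obtain ⟨σ, hσ⟩ := exists_diametral_of_height hc hv hd hvol
  have key : ∀ f : Plane, ‖f‖ = 1 → 0 ≤ f 0 →
      ∃ p ∈ K, ∃ q ∈ K, p - q = (2 : ℝ) • f ∧ p 1 + q 1 = σ := by
    intro f hf hf0
    have hf' := norm_sq_eq_plane f
    rw [hf] at hf'
    obtain ⟨p, hp, q, hq, h1, h2, h3⟩ := hσ (f 1)
      (abs_le.1 (abs_le_of_sq_le_sq (by nlinarith) zero_le_one))
    refine ⟨p, hp, q, hq, ?_, h1⟩
    rw [show (2 : ℝ) ^ 2 - (2 * f 1) ^ 2 = (2 * f 0) ^ 2 by nlinarith,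
      Real.sqrt_sq (by positivity)] at h3
    ext i
    fin_cases i
    · simpa using h3
    · simpa using h2
  have key2 : ∀ p ∈ K, ∀ q ∈ K, dist p q = 2 → q 0 ≤ p 0 → p 1 + q 1 = σ := by
    intro p hp q hq hpq h0
    obtain ⟨p', hp', q', hq', h, hs⟩ := key ((1 / 2 : ℝ) • (p - q))
      (by rw [norm_smul, ← dist_eq_norm, hpq]; norm_num) (by simpa using h0)
    rw [smul_smul, show (2 : ℝ) * (1 / 2) = 1 by norm_num, one_smul] at h
    have e1 := eq_of_parallel_diametral hd hp hq hp' hq' hpq h.symm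
    subst e1
    rw [sub_right_inj] at h
    rwa [← h]
  refine ⟨σ, fun p hp q hq hpq => ?_, fun f hf => ?_⟩
  · rcases le_total (q 0) (p 0) with h | h
    · exact key2 p hp q hq hpq h
    · rw [add_comm]
      exact key2 q hq p hp (dist_comm p q ▸ hpq) h
  · rcases le_total 0 (f 0) with h | h
    · obtain ⟨p, hp, q, hq, h, -⟩ := key f hf h
      exact ⟨p, hp, q, hq, h⟩
    · obtain ⟨p, hp, q, hq, h, -⟩ := key (-f) (by simpa using hf) (by simpa using h)
      exact ⟨q, hq, p, hp, by rw [← neg_sub, h]; simp⟩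

/-- A compact convex planar set of diameter at most `2` and area at least `π` contains a
unit disk. -/
lemma exists_closedBall_subset {K : Set Plane} (hc : IsCompact K) (hv : Convex ℝ K)
    (hd : ∀ p ∈ K, ∀ q ∈ K, dist p q ≤ 2) (hvol : ENNReal.ofReal Real.pi ≤ volume K) :
    ∃ c, Metric.closedBall c 1 ⊆ K := by
  obtain ⟨σ, hσ, hex⟩ := exists_diametral hc hv hd hvol
  let S : Plane ≃ₗᵢ[ℝ] Plane := LinearIsometryEquiv.piLpCongrLeft 2 ℝ ℝ (Equiv.swap 0 1)
  have hS1 : ∀ z : Plane, (S z) 1 = z 0 := fun z => by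
    simp [S, LinearIsometryEquiv.piLpCongrLeft_apply, Equiv.piCongrLeft']
  obtain ⟨τ, hτ, -⟩ := exists_diametral (K := S '' K) (hc.image S.continuous)
    (hv.is_linear_image S.toLinearEquiv.toLinearMap.isLinear)
    (by rintro _ ⟨p, hp, rfl⟩ _ ⟨q, hq, rfl⟩; rw [S.isometry.dist_eq]; exact hd p hp q hq)
    (by rwa [← S.measurePreserving.measure_preimage_emb S.toHomeomorph.measurableEmbedding,
          Set.preimage_image_eq _ S.injective])
  have hτ' : ∀ p ∈ K, ∀ q ∈ K, dist p q = 2 → p 0 + q 0 = τ := fun p hp q hq hpq => by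
    simpa only [hS1] using hτ _ ⟨p, hp, rfl⟩ _ ⟨q, hq, rfl⟩ (by rwa [S.isometry.dist_eq])
  refine ⟨!₂[τ / 2, σ / 2], ?_⟩
  rw [← convexHull_sphere_eq_closedBall _ zero_le_one]
  refine convexHull_min (fun z hz => ?_) hv
  rw [mem_sphere_iff_norm] at hz
  obtain ⟨p, hp, q, hq, h⟩ := hex _ hz
  have hpq : dist p q = 2 := by rw [dist_eq_norm, h, norm_smul, hz]; norm_num
  have h0 : p 0 - q 0 = 2 * (z 0 - τ / 2) := congrArg (fun z : Plane => z 0) h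
  have h1 : p 1 - q 1 = 2 * (z 1 - σ / 2) := congrArg (fun z : Plane => z 1) h
  have e0 := hτ' p hp q hq hpq
  have e1 := hσ p hp q hq hpq
  have : z = p := by
    ext i
    fin_cases i
    · change z 0 = p 0
      linarith
    · change z 1 = p 1
      linarith
  rwa [this]

lemma dist_le_of_mem_closure {S : Set Plane} {d : ℝ} (h : ∀ p ∈ S, ∀ q ∈ S, dist p q ≤ d) :
    ∀ p ∈ closure S, ∀ q ∈ closure S, dist p q ≤ d := by
  have h1 : ∀ p ∈ S, ∀ q ∈ closure S, dist p q ≤ d := fun p hp =>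
    closure_minimal (t := {q | dist p q ≤ d}) (h p hp)
      (isClosed_le (by fun_prop) continuous_const)
  intro p hp q hq
  exact closure_minimal (t := {p | dist p q ≤ d}) (fun p hp => h1 p hp q hq)
    (isClosed_le (by fun_prop) continuous_const) hp

lemma dist_le_of_mem_closure_convexHull {S : Set Plane} {d : ℝ}
    (h : ∀ p ∈ S, ∀ q ∈ S, dist p q ≤ d) :
    ∀ p ∈ closure (convexHull ℝ S), ∀ q ∈ closure (convexHull ℝ S), dist p q ≤ d := by
  refine dist_le_of_mem_closure fun p hp q hq => ?_
  obtain ⟨p', hp', q', hq', hle⟩ := convexHull_exists_dist_ge2 hp hq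
  exact hle.trans (h p' hp' q' hq')

lemma subset_closure_convexHull (S : Set Plane) : S ⊆ closure (convexHull ℝ S) :=
  (subset_convexHull ℝ S).trans subset_closure

lemma isCompact_closure_convexHull {S : Set Plane} (h : Bornology.IsBounded S) :
    IsCompact (closure (convexHull ℝ S)) :=
  ((isBounded_convexHull (s := S)).2 h).isCompact_closure

lemma closure_convexHull_subset {S T : Set Plane} (h : S ⊆ T) (hT : Convex ℝ T)
    (hT' : IsClosed T) : closure (convexHull ℝ S) ⊆ T :=
  closure_minimal (convexHull_min h hT) hT'

/-- The lowest face of a closed convex hull meets both sides of any of its points. -/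
lemma exists_mem_lowest_face {P : Set Plane} (hP : IsCompact P) (ε η : ℝ)
    (hη : ∀ p ∈ P, η ≤ p 1) (hq : !₂[0, η] ∈ closure (convexHull ℝ P)) :
    ∃ a ∈ P, a 1 = η ∧ ε * a 0 ≤ 0 := by
  have hcont : ∀ n : ℕ, Continuous fun p : Plane => ε * p 0 + n * p 1 := fun n => by fun_prop
  have hPne : P.Nonempty := by
    rw [← convexHull_nonempty_iff (𝕜 := ℝ), ← closure_nonempty_iff]
    exact ⟨_, hq⟩
  let C : ℕ → Set Plane := fun n => P ∩ {p | ε * p 0 + n * p 1 ≤ n * η}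
  have hCne : ∀ n, (C n).Nonempty := by
    intro n
    obtain ⟨p, hp, hmin⟩ := hP.exists_isMinOn hPne (hcont n).continuousOn
    refine ⟨p, hp, ?_⟩
    have hsub : closure (convexHull ℝ P) ⊆
        {z : Plane | ε * p 0 + n * p 1 ≤ ε * z 0 + n * z 1} := by
      refine closure_convexHull_subset (fun z hz => hmin hz) ?_
        (isClosed_le continuous_const (hcont n))
      refine convex_halfSpace_ge ⟨fun u v => ?_, fun c u => ?_⟩ _
      · simp only [PiLp.add_apply]; ring
      · simp only [PiLp.smul_apply, smul_eq_mul]; ring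
    simpa using hsub hq
  have hCcl : ∀ n, IsClosed (C n) := fun n =>
    hP.isClosed.inter (isClosed_le (hcont n) continuous_const)
  obtain ⟨a, ha⟩ := IsCompact.nonempty_iInter_of_sequence_nonempty_isCompact_isClosed C
    (fun n p hp => ⟨hp.1, by
      have h1 := hp.2
      simp only [Set.mem_ofPred_eq, Nat.cast_add, Nat.cast_one] at h1 ⊢
      linarith [hη p hp.1]⟩) hCne (hP.inter_right (isClosed_le (hcont 0) continuous_const)) hCcl
  have ha' : ∀ n : ℕ, a ∈ C n := Set.mem_iInter.1 ha
  have haP := (ha' 0).1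
  have h0 : ε * a 0 ≤ 0 := by simpa using (ha' 0).2
  refine ⟨a, haP, le_antisymm ?_ (hη a haP), h0⟩
  by_contra hlt
  obtain ⟨n, hn⟩ := exists_nat_gt (-(ε * a 0) / (a 1 - η))
  rw [div_lt_iff₀ (by linarith)] at hn
  have h1 : ε * a 0 + n * a 1 ≤ n * η := (ha' n).2
  linarith

lemma exists_crossing {A η X Y ζ : ℝ} (hη : 0 ≤ η) (hζ : η ≤ ζ) (hζ2 : ζ < 2) (hY : ζ ≤ Y)
    (hA : A ≤ 0) (hA4 : 4 ≤ A ^ 2 + η ^ 2) (hX : 8 ≤ X ^ 2 + Y ^ 2)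
    (hXA : (X - A) ^ 2 + (Y - η) ^ 2 ≤ 4) :
    ∃ l, 0 ≤ l ∧ l ≤ 1 ∧ (1 - l) * η + l * Y = ζ ∧ (1 - l) * A + l * X ≤ 0 ∧
      4 ≤ ((1 - l) * A + l * X) ^ 2 + ζ ^ 2 := by
  have hfar : ∀ l : ℝ, 0 ≤ l → l ≤ 1 →
      4 ≤ ((1 - l) * A + l * X) ^ 2 + ((1 - l) * η + l * Y) ^ 2 := by
    intro l h0 h1
    have e : ((1 - l) * A + l * X) ^ 2 + ((1 - l) * η + l * Y) ^ 2 =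
      (1 - l) * (A ^ 2 + η ^ 2) + l * (X ^ 2 + Y ^ 2) -
        l * (1 - l) * ((X - A) ^ 2 + (Y - η) ^ 2) := by ring
    rw [e]
    have i1 := mul_le_mul_of_nonneg_left hA4 (sub_nonneg.2 h1)
    have i2 := mul_le_mul_of_nonneg_left hX h0
    have i3 := mul_le_mul_of_nonneg_left hXA (mul_nonneg h0 (sub_nonneg.2 h1))
    nlinarith [sq_nonneg l]
  have hl : ∃ l, 0 ≤ l ∧ l ≤ 1 ∧ (1 - l) * η + l * Y = ζ := by
    rcases (hζ.trans hY).eq_or_lt with h | h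
    · exact ⟨0, le_rfl, zero_le_one, by linarith⟩
    · have hp : 0 < Y - η := sub_pos.2 h
      refine ⟨(ζ - η) / (Y - η), by apply div_nonneg <;> linarith,
        (div_le_one hp).2 (by linarith), ?_⟩
      field_simp
      ring
  obtain ⟨l, h0, h1, hl⟩ := hl
  refine ⟨l, h0, h1, hl, ?_, hl ▸ hfar l h0 h1⟩
  by_contra! hpos
  have hXpos : 0 < X := by
    by_contra! hX0
    nlinarith [mul_nonneg (sub_nonneg.2 h1) (neg_nonneg.2 hA), mul_nonneg h0 (neg_nonneg.2 hX0)]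
  have hXA' : 0 < X - A := by linarith
  set m := -A / (X - A) with hm
  have hmX : m * (X - A) = -A := div_mul_cancel₀ _ hXA'.ne'
  have hm0 : 0 ≤ m := div_nonneg (by linarith) hXA'.le
  have hml : m ≤ l := by
    rw [hm, div_le_iff₀ hXA']
    linarith
  have h := hfar m hm0 (hml.trans h1)
  rw [show (1 - m) * A + m * X = 0 by linarith] at h
  have hu : (1 - m) * η + m * Y ≤ ζ := by
    nlinarith [mul_nonneg (sub_nonneg.2 hml) (sub_nonneg.2 (hζ.trans hY))]
  have hv : 0 ≤ (1 - m) * η + m * Y := by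
    have := mul_nonneg (sub_nonneg.2 (hml.trans h1)) hη
    have := mul_nonneg hm0 ((hη.trans hζ).trans hY)
    linarith
  nlinarith

lemma open_cap_subset {P : Set Plane} (hP : IsCompact P) (hfar : ∀ p ∈ P, 2 ≤ ‖p‖)
    (hd : ∀ p ∈ P, ∀ q ∈ P, dist p q ≤ 2) {x : Plane} (hx : x ∈ P) (hx8 : 8 ≤ ‖x‖ ^ 2)
    {η : ℝ} (hη0 : 0 ≤ η) (hη : ∀ p ∈ P, η ≤ p 1)
    (hq : !₂[0, η] ∈ closure (convexHull ℝ P)) :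
    {z : Plane | ‖z‖ < 2 ∧ η ≤ z 1} ⊆ closure (convexHull ℝ P) := by
  rintro z ⟨hz, hzη⟩
  have hPK := subset_closure_convexHull P
  have hK : Convex ℝ (closure (convexHull ℝ P)) := (convex_convexHull ℝ P).closure
  have hz4 : z 0 ^ 2 + z 1 ^ 2 < 4 := by
    rw [← norm_sq_eq_plane]
    nlinarith [norm_nonneg z]
  have hz2 : z 1 < 2 := by nlinarith [sq_nonneg (z 0)]
  have hface : ∀ ε : ℝ, ∃ a ∈ P, a 1 = η ∧ ε * a 0 ≤ 0 := fun ε =>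
    exists_mem_lowest_face hP ε η hη hq
  rw [norm_sq_eq_plane] at hx8
  have hdx : ∀ a ∈ P, (x 0 - a 0) ^ 2 + (x 1 - a 1) ^ 2 ≤ 4 := by
    intro a ha
    rw [← dist_sq_eq]
    nlinarith [hd x hx a ha, dist_nonneg (x := x) (y := a)]
  have hx1 : z 1 ≤ x 1 := by
    by_contra! hlt
    have hx0 : 0 ≤ x 1 := hη0.trans (hη x hx)
    have h4 : 4 < x 0 ^ 2 := by nlinarith
    obtain ⟨a, ha, -, ha0⟩ := hface (x 0)
    nlinarith [hdx a ha, sq_nonneg (x 1 - a 1), sq_nonneg (a 0)]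
  have hside : ∀ ε : ℝ, ε ^ 2 = 1 → ∃ α, !₂[α, z 1] ∈ closure (convexHull ℝ P) ∧
      ε * α ≤ 0 ∧ z 0 ^ 2 < α ^ 2 := by
    intro ε hε
    obtain ⟨a, ha, ha1, ha0⟩ := hface ε
    have ha4 : 4 ≤ a 0 ^ 2 + a 1 ^ 2 := by
      rw [← norm_sq_eq_plane]
      nlinarith [hfar a ha]
    obtain ⟨l, h0, h1, hl, hneg, h4⟩ := exists_crossing (A := ε * a 0) (X := ε * x 0)
      hη0 hzη hz2 hx1 ha0 (by rw [mul_pow, hε, ← ha1]; linarith)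
      (by rw [mul_pow, hε]; linarith)
      (by rw [← mul_sub, mul_pow, hε, ← ha1]; linarith [hdx a ha])
    refine ⟨(1 - l) * a 0 + l * x 0, ?_, by linarith, ?_⟩
    · have hmem := hK (hPK ha) (hPK hx) (sub_nonneg.2 h1) h0 (by ring)
      convert hmem using 1
      ext i
      fin_cases i
      · simp
      · simp [ha1, hl]
    · have e : ((1 - l) * (ε * a 0) + l * (ε * x 0)) ^ 2 =
          ε ^ 2 * ((1 - l) * a 0 + l * x 0) ^ 2 := by ring
      rw [e, hε] at h4
      linarith
  obtain ⟨α, hα, hα0, hα2⟩ := hside 1 (by norm_num)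
  obtain ⟨β, hβ, hβ0, hβ2⟩ := hside (-1) (by norm_num)
  have hα' : α < z 0 := by
    have := sq_lt_sq.1 hα2
    linarith [neg_abs_le (z 0), abs_of_nonpos (by linarith : α ≤ 0)]
  have hβ' : z 0 < β := by
    have := sq_lt_sq.1 hβ2
    linarith [le_abs_self (z 0), abs_of_nonneg (by linarith : 0 ≤ β)]
  have hβα : 0 < β - α := by linarith
  have hmem := hK hα hβ (a := (β - z 0) / (β - α)) (b := (z 0 - α) / (β - α))
    (div_nonneg (by linarith) hβα.le) (div_nonneg (by linarith) hβα.le)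
    (by field_simp; ring)
  convert hmem using 1
  ext i
  fin_cases i
  · simp
    field_simp
    ring
  · simp
    field_simp
    ring

lemma semichordIntegral_two_two : semichordIntegral 2 2 = Real.pi := by
  rw [semichordIntegral_self zero_le_two]
  ring

lemma slice_cap (h t : ℝ) :
    slice {p : Plane | ‖p‖ ≤ 2 ∧ h ≤ p 1} t =
      {r : ℝ | h ≤ t ∧ r ^ 2 + t ^ 2 ≤ 2 ^ 2} := by
  ext r
  have := norm_sq_eq_plane !₂[r, t]
  simp only [Matrix.cons_val_zero, Matrix.cons_val_one] at this
  change (‖!₂[r, t]‖ ≤ 2 ∧ h ≤ t) ↔ _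
  rw [Set.mem_ofPred_eq, ← this, pow_le_pow_iff_left₀ (norm_nonneg _) zero_le_two two_ne_zero,
    and_comm]

lemma measurableSet_cap (h : ℝ) : MeasurableSet {p : Plane | ‖p‖ ≤ 2 ∧ h ≤ p 1} :=
  ((isClosed_le (f := fun p : Plane => ‖p‖) continuous_norm continuous_const).inter
    (isClosed_le (f := fun _ : Plane => h) (g := fun p : Plane => p 1) continuous_const
      (by fun_prop))).measurableSet

lemma volume_cap {h : ℝ} (h0 : 0 ≤ h) (h2 : h ≤ 2) :
    volume {p : Plane | ‖p‖ ≤ 2 ∧ h ≤ p 1} =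
      ENNReal.ofReal (2 * Real.pi - 2 * semichordIntegral 2 h) := by
  have hm := measurableSet_cap h
  have hsl : ∀ t : ℝ, volume (slice {p : Plane | ‖p‖ ≤ 2 ∧ h ≤ p 1} t) =
      (Set.Icc h 2).indicator (fun t => ENNReal.ofReal (2 * √(2 ^ 2 - t ^ 2))) t := by
    intro t
    rw [slice_cap]
    by_cases ht : t ∈ Set.Icc h 2
    · rw [Set.indicator_of_mem ht]
      have : {r : ℝ | h ≤ t ∧ r ^ 2 + t ^ 2 ≤ 2 ^ 2} =
          Set.Icc (-√(2 ^ 2 - t ^ 2)) √(2 ^ 2 - t ^ 2) := by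
        ext r
        rw [Set.mem_ofPred_eq, Set.mem_Icc, ← abs_le, Real.le_sqrt (abs_nonneg _)
          (by nlinarith [ht.1, ht.2]), sq_abs, le_sub_iff_add_le]
        exact and_iff_right ht.1
      rw [this, Real.volume_Icc]
      ring_nf
    · rw [Set.indicator_of_notMem ht]
      have : {r : ℝ | h ≤ t ∧ r ^ 2 + t ^ 2 ≤ 2 ^ 2} = ∅ := by
        refine Set.eq_empty_of_forall_notMem fun r hr => ht ⟨hr.1, ?_⟩
        nlinarith [hr.1, hr.2, sq_nonneg r]
      rw [this, measure_empty]
  have hc : Continuous fun t : ℝ => 2 * √(2 ^ 2 - t ^ 2) := by fun_prop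
  rw [volume_eq_lintegral_slice hm]
  change ∫⁻ t, volume (slice {p : Plane | ‖p‖ ≤ 2 ∧ h ≤ p 1} t) = _
  simp only [hsl]
  rw [lintegral_indicator measurableSet_Icc, ← ofReal_integral_eq_lintegral_ofReal
    hc.integrableOn_Icc (.of_forall fun t => by positivity), integral_Icc_eq_integral_Ioc,
    ← intervalIntegral.integral_of_le h2, intervalIntegral.integral_const_mul]
  congr 1
  rw [← semichordIntegral_two_two]
  unfold semichordIntegral
  rw [← intervalIntegral.integral_add_adjacent_intervals (a := 0) (b := h) (c := 2)
    ((continuous_semichord 2).intervalIntegrable _ _)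
    ((continuous_semichord 2).intervalIntegrable _ _)]
  ring

lemma volume_cap_le_open_cap (h : ℝ) :
    volume {p : Plane | ‖p‖ ≤ 2 ∧ h ≤ p 1} ≤ volume {p : Plane | ‖p‖ < 2 ∧ h ≤ p 1} := by
  have hsub : {p : Plane | ‖p‖ ≤ 2 ∧ h ≤ p 1} ⊆
      {p : Plane | ‖p‖ < 2 ∧ h ≤ p 1} ∪ Metric.sphere 0 2 := by
    rintro p ⟨hp, hp'⟩
    rcases hp.lt_or_eq with hlt | heq
    · exact Or.inl ⟨hlt, hp'⟩
    · exact Or.inr (by simpa using heq)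
  refine (measure_mono hsub).trans ((measure_union_le _ _).trans ?_)
  rw [Measure.addHaar_sphere, add_zero]

/-- A linear isometry of the plane sending a given vector to the upper vertical half-axis. -/
lemma exists_isometry_vertical (v : Plane) :
    ∃ L : Plane ≃ₗᵢ[ℝ] Plane, L v = !₂[0, ‖v‖] ∧ ∀ w, ‖v‖ * (L w) 1 = inner ℝ v w := by
  have hn : ‖v‖ = ‖(!₂[0, ‖v‖] : Plane)‖ := by
    have h := norm_sq_eq_plane !₂[0, ‖v‖]
    simp only [Matrix.cons_val_zero, Matrix.cons_val_one] at h
    exact (pow_left_inj₀ (norm_nonneg _) (norm_nonneg _) two_ne_zero).1 (by linarith)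
  refine ⟨(ℝ ∙ (v - !₂[0, ‖v‖]))ᗮ.reflection, Submodule.reflection_sub hn, fun w => ?_⟩
  rw [← LinearIsometryEquiv.inner_map_map (ℝ ∙ (v - !₂[0, ‖v‖]))ᗮ.reflection v w,
    Submodule.reflection_sub hn, PiLp.inner_apply, Fin.sum_univ_two]
  simp [mul_comm]

lemma volume_half_lens {x y : Plane} (h0 : 0 < dist x y) (h4 : dist x y ≤ 4) :
    volume {p : Plane | dist p x ≤ 2 ∧ dist x y ^ 2 / 2 ≤ inner ℝ (y - x) (p - x)} =
      ENNReal.ofReal (2 * Real.pi - 2 * semichordIntegral 2 (dist x y / 2)) := by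
  obtain ⟨L, -, hL⟩ := exists_isometry_vertical (y - x)
  rw [← dist_eq_norm, dist_comm] at hL
  rw [← volume_cap (by positivity) (by linarith)]
  have hmp : MeasurePreserving (fun p : Plane => L (p - x)) volume volume :=
    L.measurePreserving.comp (measurePreserving_sub_right volume x)
  have hm := measurableSet_cap (dist x y / 2)
  rw [← hmp.measure_preimage hm.nullMeasurableSet]
  congr 1
  ext p
  simp only [Set.mem_ofPred_eq, Set.mem_preimage, LinearIsometryEquiv.norm_map, dist_eq_norm p x]
  rw [← hL, show dist x y ^ 2 / 2 = dist x y * (dist x y / 2) by ring,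
    mul_le_mul_iff_right₀ h0]

lemma volume_lens_le {x y : Plane} (h0 : 0 < dist x y) (h4 : dist x y ≤ 4) :
    volume {p : Plane | dist p x ≤ 2 ∧ dist p y ≤ 2} ≤
      ENNReal.ofReal (4 * Real.pi - 4 * semichordIntegral 2 (dist x y / 2)) := by
  have hsub : {p : Plane | dist p x ≤ 2 ∧ dist p y ≤ 2} ⊆
      {p : Plane | dist p x ≤ 2 ∧ dist x y ^ 2 / 2 ≤ inner ℝ (y - x) (p - x)} ∪
      {p : Plane | dist p y ≤ 2 ∧ dist y x ^ 2 / 2 ≤ inner ℝ (x - y) (p - y)} := by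
    rintro p ⟨hx, hy⟩
    by_contra hn
    simp only [Set.mem_union, Set.mem_ofPred_eq, hx, hy, true_and, not_or, not_le] at hn
    have e : inner ℝ (y - x) (p - x) + inner ℝ (x - y) (p - y) = dist x y ^ 2 := by
      rw [dist_comm, dist_eq_norm, ← real_inner_self_eq_norm_sq, ← neg_sub y x, inner_neg_left,
        ← sub_eq_add_neg, ← inner_sub_right]
      congr 1
      abel
    rw [dist_comm y x] at hn
    linarith [hn.1, hn.2]
  refine (measure_mono hsub).trans ((measure_union_le _ _).trans ?_)
  rw [volume_half_lens h0 h4, volume_half_lens (dist_comm x y ▸ h0) (dist_comm x y ▸ h4),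
    dist_comm y x, ← ENNReal.ofReal_add]
  · exact ENNReal.ofReal_le_ofReal (by linarith)
  all_goals
    have h := semichordIntegral_le_self zero_le_two (dist x y / 2)
    linarith

lemma volume_add_cap_le {P : Set Plane} (hP : IsCompact P) (hfar : ∀ p ∈ P, 2 ≤ ‖p‖)
    {D : ℝ} (hD : ∀ p ∈ P, ‖p‖ ≤ D) (hd : ∀ p ∈ P, ∀ q ∈ P, dist p q ≤ 2)
    {x : Plane} (hx : x ∈ P) (hx8 : 8 ≤ ‖x‖ ^ 2)
    {η : ℝ} (hη0 : 0 ≤ η) (hη2 : η ≤ 2) (hη : ∀ p ∈ P, η ≤ p 1)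
    (hq : !₂[0, η] ∈ closure (convexHull ℝ P)) :
    volume P + ENNReal.ofReal (2 * Real.pi - 2 * semichordIntegral 2 η) ≤
      ENNReal.ofReal (semichordIntegral 2 (D - η)) := by
  have hcont : Continuous fun p : Plane => p 1 := by fun_prop
  have hlin : IsLinearMap ℝ fun p : Plane => p 1 := ⟨fun _ _ => rfl, fun _ _ => rfl⟩
  have hKs : closure (convexHull ℝ P) ⊆ {p : Plane | p 1 ∈ Set.Icc η D} := by
    refine closure_convexHull_subset (fun p hp => ⟨hη p hp, ?_⟩)
      ((convex_halfSpace_ge hlin η).inter (convex_halfSpace_le hlin D))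
      (isClosed_Icc.preimage hcont)
    exact (le_abs_self _).trans ((PiLp.norm_apply_le p 1).trans (hD p hp))
  refine le_trans ?_ (volume_le_of_ediam_of_strip (isCompact_closure_convexHull hP.isBounded)
    (convex_convexHull ℝ P).closure (dist_le_of_mem_closure_convexHull hd) hKs)
  rw [← volume_cap hη0 hη2]
  refine (add_le_add_right (volume_cap_le_open_cap η) _).trans ?_
  rw [← measure_union' _ hP.measurableSet]
  · exact measure_mono (Set.union_subset (subset_closure_convexHull P)
      (open_cap_subset hP hfar hd hx hx8 hη0 hη hq))
  · exact Set.disjoint_left.2 fun p hp hp' => (hfar p hp).not_gt hp'.1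

lemma pi_lt_two_mul_semichordIntegral {h : ℝ} (h1 : 1 < h) (h2 : h ≤ 2) :
    Real.pi < 2 * semichordIntegral 2 h := by
  have hc := strictConcaveOn_semichordIntegral.concaveOn.2
    (show (0 : ℝ) ∈ Set.Icc 0 2 by simp) (show (2 : ℝ) ∈ Set.Icc 0 2 by simp)
    (show 0 ≤ 1 - h / 2 by linarith) (show 0 ≤ h / 2 by linarith) (by ring)
  have h0 : semichordIntegral 2 0 = 0 := by simp [semichordIntegral]
  simp only [smul_eq_mul, h0, semichordIntegral_two_two] at hc
  rw [show (1 - h / 2) * 0 + h / 2 * 2 = h by ring] at hc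
  nlinarith [Real.pi_pos]

lemma volume_far_lt_of_center_zero {P : Set Plane} (hP : IsCompact P) (hfar : ∀ p ∈ P, 2 ≤ ‖p‖)
    {D : ℝ} (hD8 : 8 ≤ D ^ 2) (hD0 : 2 < D) (hD4 : D < 4) (hD : ∀ p ∈ P, ‖p‖ ≤ D)
    (hd : ∀ p ∈ P, ∀ q ∈ P, dist p q ≤ 2) {x : Plane} (hx : x ∈ P) (hxD : ‖x‖ = D) :
    volume P < ENNReal.ofReal (2 * semichordIntegral 2 (D / 2) - Real.pi) := by
  have hJpos : 0 < 2 * semichordIntegral 2 (D / 2) - Real.pi :=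
    sub_pos.2 (pi_lt_two_mul_semichordIntegral (by linarith) (by linarith))
  have hK := (convex_convexHull ℝ P).closure
  have hKc := isCompact_closure_convexHull hP.isBounded
  have hPK := subset_closure_convexHull P
  obtain ⟨q, hq, hmin⟩ := exists_norm_eq_iInf_of_complete_convex ⟨x, hPK hx⟩
    hKc.isClosed.isComplete hK 0
  rw [norm_eq_iInf_iff_real_inner_le_zero hK hq] at hmin
  have hq1 : D - 2 ≤ ‖q‖ := by
    have h1 := dist_le_of_mem_closure_convexHull hd x (hPK hx) q hq
    rw [dist_eq_norm] at h1
    linarith [norm_sub_norm_le x q]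
  have hinner : ∀ w ∈ P, ‖q‖ * ‖q‖ ≤ inner ℝ q w := by
    intro w hw
    have h1 := hmin w (hPK hw)
    rw [zero_sub, inner_neg_left, inner_sub_right, real_inner_self_eq_norm_mul_norm] at h1
    linarith
  obtain ⟨L, hLq, hL⟩ := exists_isometry_vertical q
  have hcl : closure (convexHull ℝ (L '' P)) = L '' closure (convexHull ℝ P) := by
    have h1 : L '' convexHull ℝ P = convexHull ℝ (L '' P) :=
      L.toLinearEquiv.toLinearMap.isLinear.image_convexHull P
    rw [← h1]
    exact (L.toHomeomorph.image_closure _).symm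
  have hvol : volume (L '' P) = volume P := by
    rw [← L.measurePreserving.measure_preimage_emb L.toHomeomorph.measurableEmbedding,
      Set.preimage_image_eq _ L.injective]
  have hheight : ∀ p ∈ L '' P, ‖q‖ ≤ p 1 := by
    rintro _ ⟨p, hp, rfl⟩
    have h1 := hinner p hp
    rw [← hL p] at h1
    exact le_of_mul_le_mul_left h1 (by linarith)
  have hLD : ∀ p ∈ L '' P, ‖p‖ ≤ D := by
    rintro _ ⟨p, hp, rfl⟩
    simpa using hD p hp
  have hLd : ∀ p ∈ L '' P, ∀ q ∈ L '' P, dist p q ≤ 2 := by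
    rintro _ ⟨p, hp, rfl⟩ _ ⟨q, hq, rfl⟩
    rw [L.isometry.dist_eq]
    exact hd p hp q hq
  have hLfar : ∀ p ∈ L '' P, 2 ≤ ‖p‖ := by
    rintro _ ⟨p, hp, rfl⟩
    simpa using hfar p hp
  have hconc := strictConcaveOn_semichordIntegral
  rw [← hvol]
  rcases lt_or_ge ‖q‖ 2 with hlt | hge
  · have hmain := volume_add_cap_le (hP.image L.continuous) hLfar hLD hLd
      (Set.mem_image_of_mem L hx) (by rw [L.norm_map, hxD]; exact hD8) (norm_nonneg q) hlt.le
      hheight (by rw [hcl, ← hLq]; exact Set.mem_image_of_mem L hq)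
    have hJη : semichordIntegral 2 ‖q‖ < Real.pi := by
      rw [← semichordIntegral_two_two]
      exact strictMonoOn_semichordIntegral ⟨norm_nonneg q, hlt.le⟩ (by simp) hlt
    have h1 := hconc.concaveOn.2
      (show D - ‖q‖ ∈ Set.Icc (0 : ℝ) 2 from ⟨by linarith, by linarith⟩)
      (show ‖q‖ ∈ Set.Icc (0 : ℝ) 2 from ⟨norm_nonneg q, hlt.le⟩)
      (show (0 : ℝ) ≤ 1 / 2 by norm_num) (show (0 : ℝ) ≤ 1 / 2 by norm_num) (by norm_num)
    simp only [smul_eq_mul] at h1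
    rw [show 1 / 2 * (D - ‖q‖) + 1 / 2 * ‖q‖ = D / 2 by ring] at h1
    refine (ENNReal.le_sub_of_add_le_right ENNReal.ofReal_ne_top hmain).trans_lt ?_
    rw [← ENNReal.ofReal_sub _ (by linarith)]
    exact (ENNReal.ofReal_lt_ofReal_iff hJpos).2 (by linarith)
  · have hmain := volume_le_of_ediam_of_strip (a := 2) (b := D)
      (isCompact_closure_convexHull (hP.image L.continuous).isBounded)
      (convex_convexHull ℝ (L '' P)).closure (dist_le_of_mem_closure_convexHull hLd) (by
        have hlin : IsLinearMap ℝ fun p : Plane => p 1 := ⟨fun _ _ => rfl, fun _ _ => rfl⟩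
        refine closure_convexHull_subset (T := {p : Plane | p 1 ∈ Set.Icc 2 D})
          (fun p hp => ⟨hge.trans (hheight p hp), ?_⟩)
          ((convex_halfSpace_ge hlin 2).inter (convex_halfSpace_le hlin D))
          (isClosed_Icc.preimage (by fun_prop))
        exact (le_abs_self _).trans ((PiLp.norm_apply_le p 1).trans (hLD p hp)))
    refine ((measure_mono (subset_closure_convexHull _)).trans hmain).trans_lt
      ((ENNReal.ofReal_lt_ofReal_iff hJpos).2 ?_)
    have h1 := hconc.2 (show D - 2 ∈ Set.Icc (0 : ℝ) 2 from ⟨by linarith, by linarith⟩)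
      (show (2 : ℝ) ∈ Set.Icc (0 : ℝ) 2 by simp) (by linarith)
      (show (0 : ℝ) < 1 / 2 by norm_num) (show (0 : ℝ) < 1 / 2 by norm_num) (by norm_num)
    simp only [smul_eq_mul, semichordIntegral_two_two] at h1
    rw [show 1 / 2 * (D - 2) + 1 / 2 * 2 = D / 2 by ring] at h1
    linarith

lemma volume_far_lt {P : Set Plane} (hP : IsCompact P) {x y : Plane}
    (hfar : ∀ p ∈ P, 2 ≤ dist p y) (h8 : 8 ≤ dist x y ^ 2) (h4 : dist x y < 4)
    (hD : ∀ p ∈ P, dist p y ≤ dist x y) (hd : ∀ p ∈ P, ∀ q ∈ P, dist p q ≤ 2) (hx : x ∈ P) :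
    volume P < ENNReal.ofReal (2 * semichordIntegral 2 (dist x y / 2) - Real.pi) := by
  have hvol : volume ((fun p => p - y) '' P) = volume P := by
    simp only [sub_eq_add_neg, Set.image_add_right, neg_neg, measure_preimage_add_right]
  rw [← hvol]
  refine volume_far_lt_of_center_zero (hP.image (by fun_prop)) ?_ h8
    (by nlinarith [dist_nonneg (x := x) (y := y)]) h4 ?_ ?_ (Set.mem_image_of_mem _ hx)
    (dist_eq_norm x y).symm
  · rintro _ ⟨p, hp, rfl⟩
    simpa [dist_eq_norm] using hfar p hp
  · rintro _ ⟨p, hp, rfl⟩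
    simpa [dist_eq_norm] using hD p hp
  · rintro _ ⟨p, hp, rfl⟩ _ ⟨q, hq, rfl⟩
    simpa using hd p hp q hq

lemma not_pairwise_far_of_mem_closure {A : Set Plane}
    (h : ∀ x ∈ A, ∀ y ∈ A, ∀ z ∈ A, ¬(2 < dist x y ∧ 2 < dist x z ∧ 2 < dist y z)) :
    ∀ x ∈ closure A, ∀ y ∈ closure A, ∀ z ∈ closure A,
      ¬(2 < dist x y ∧ 2 < dist x z ∧ 2 < dist y z) := by
  intro x hx y hy z hz hn
  have hopen : IsOpen {p : Plane × Plane × Plane |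
      2 < dist p.1 p.2.1 ∧ 2 < dist p.1 p.2.2 ∧ 2 < dist p.2.1 p.2.2} := by
    have hlt {f g : Plane × Plane × Plane → Plane} (hf : Continuous f) (hg : Continuous g) :
        IsOpen {p | 2 < dist (f p) (g p)} := isOpen_lt continuous_const (hf.dist hg)
    exact (hlt continuous_fst (continuous_fst.comp continuous_snd)).inter
      ((hlt continuous_fst (continuous_snd.comp continuous_snd)).inter
        (hlt (continuous_fst.comp continuous_snd) (continuous_snd.comp continuous_snd)))
  have hmem : (x, y, z) ∈ closure (A ×ˢ A ×ˢ A) := by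
    rw [closure_prod_eq, closure_prod_eq]
    exact ⟨hx, hy, hz⟩
  obtain ⟨p, hp, hpA⟩ := mem_closure_iff.1 hmem _ hopen hn
  exact h _ hpA.1 _ hpA.2.1 _ hpA.2.2 hp

lemma isBounded_of_not_pairwise_far {A : Set Plane}
    (h : ∀ x ∈ A, ∀ y ∈ A, ∀ z ∈ A, ¬(2 < dist x y ∧ 2 < dist x z ∧ 2 < dist y z)) :
    Bornology.IsBounded A := by
  by_cases hs : ∀ x ∈ A, ∀ y ∈ A, dist x y ≤ 2
  · exact Metric.isBounded_iff.2 ⟨2, fun x hx y hy => hs x hx y hy⟩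
  · push Not at hs
    obtain ⟨x, hx, y, hy, hxy⟩ := hs
    refine (Metric.isBounded_closedBall (x := x) (r := 2)).union
      (Metric.isBounded_closedBall (x := y) (r := 2)) |>.subset fun z hz => ?_
    by_contra hn
    simp only [Set.mem_union, Metric.mem_closedBall, not_or, not_le] at hn
    exact h x hx y hy z hz ⟨hxy, by rw [dist_comm]; exact hn.1, by rw [dist_comm]; exact hn.2⟩

lemma volume_le_of_dist_le_of_isCompact {P : Set Plane} (hP : IsCompact P) {d : ℝ} (hd0 : 0 ≤ d)
    (hd : ∀ p ∈ P, ∀ q ∈ P, dist p q ≤ d) : volume P ≤ ENNReal.ofReal (Real.pi * d ^ 2 / 4) :=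
  (measure_mono (subset_closure_convexHull P)).trans
    (volume_le_of_dist_le (isCompact_closure_convexHull hP.isBounded)
      (convex_convexHull ℝ P).closure hd0 (dist_le_of_mem_closure_convexHull hd))

lemma volume_closedBall_one (c : Plane) :
    volume (Metric.closedBall c 1) = ENNReal.ofReal Real.pi := by
  rw [EuclideanSpace.volume_closedBall_fin_two, ENNReal.ofReal_one, one_pow, one_mul]

/-- The equality case of the planar isodiametric inequality. -/
lemma ae_eq_closedBall_of_pi_le_volume {P : Set Plane} (hP : IsCompact P)
    (hd : ∀ p ∈ P, ∀ q ∈ P, dist p q ≤ 2) (hvol : ENNReal.ofReal Real.pi ≤ volume P) :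
    ∃ c, P =ᵐ[volume] Metric.closedBall c 1 := by
  have hPK := subset_closure_convexHull P
  have hKc := isCompact_closure_convexHull hP.isBounded
  have hK := (convex_convexHull ℝ P).closure
  have hKd := dist_le_of_mem_closure_convexHull hd
  have hKvol : volume (closure (convexHull ℝ P)) ≤ ENNReal.ofReal Real.pi := by
    have h1 := volume_le_of_dist_le hKc hK zero_le_two hKd
    rwa [show Real.pi * 2 ^ 2 / 4 = Real.pi by ring] at h1
  obtain ⟨c, hc⟩ := exists_closedBall_subset hKc hK hKd (hvol.trans (measure_mono hPK))
  refine ⟨c, (ae_eq_of_subset_of_measure_ge hPK (hKvol.trans hvol)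
    hP.measurableSet.nullMeasurableSet hKc.measure_lt_top.ne).trans
    (ae_eq_of_subset_of_measure_ge hc (hKvol.trans (volume_closedBall_one c).ge)
      Metric.isClosed_closedBall.measurableSet.nullMeasurableSet hKc.measure_lt_top.ne).symm⟩

/-- The closure of the points of a compact set at distance more than two from `y`. -/
def farPart (B : Set Plane) (y : Plane) : Set Plane := closure (B \ Metric.closedBall y 2)

lemma farPart_subset {B : Set Plane} (hB : IsCompact B) (y : Plane) : farPart B y ⊆ B :=
  closure_minimal Set.sdiff_subset hB.isClosed

lemma isCompact_farPart {B : Set Plane} (hB : IsCompact B) (y : Plane) :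
    IsCompact (farPart B y) :=
  hB.of_isClosed_subset isClosed_closure (farPart_subset hB y)

lemma two_le_dist_of_mem_farPart {B : Set Plane} {y : Plane} :
    ∀ p ∈ farPart B y, 2 ≤ dist p y := by
  refine closure_minimal (t := {p | 2 ≤ dist p y}) (fun p hp => ?_)
    (isClosed_le continuous_const (by fun_prop))
  have h1 := hp.2
  rw [Metric.mem_closedBall, not_le] at h1
  exact h1.le

lemma dist_le_of_mem_farPart {B : Set Plane} {y : Plane} (hy : y ∈ B)
    (h : ∀ x ∈ B, ∀ y ∈ B, ∀ z ∈ B, ¬(2 < dist x y ∧ 2 < dist x z ∧ 2 < dist y z)) :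
    ∀ p ∈ farPart B y, ∀ q ∈ farPart B y, dist p q ≤ 2 := by
  refine dist_le_of_mem_closure fun p hp q hq => ?_
  by_contra hn
  have h1 := hp.2
  have h2 := hq.2
  rw [Metric.mem_closedBall, not_le] at h1 h2
  exact h p hp.1 q hq.1 y hy ⟨not_le.1 hn, h1, h2⟩

lemma mem_farPart {B : Set Plane} {x y : Plane} (hx : x ∈ B) (hxy : 2 < dist x y) :
    x ∈ farPart B y :=
  subset_closure ⟨hx, by rwa [Metric.mem_closedBall, not_le]⟩

lemma subset_farPart_union (B : Set Plane) (x y : Plane) :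
    B ⊆ farPart B y ∪ farPart B x ∪ {p | dist p x ≤ 2 ∧ dist p y ≤ 2} := by
  intro p hp
  rcases lt_or_ge 2 (dist p y) with h1 | h1
  · exact Or.inl (Or.inl (mem_farPart hp h1))
  rcases lt_or_ge 2 (dist p x) with h2 | h2
  · exact Or.inl (Or.inr (mem_farPart hp h2))
  exact Or.inr ⟨h2, h1⟩

/-- A compact set of area at least `2π` without three points at pairwise distances greater than two
has diameter at least four. -/
lemma exists_four_le_dist {B : Set Plane} (hB : IsCompact B)
    (h : ∀ x ∈ B, ∀ y ∈ B, ∀ z ∈ B, ¬(2 < dist x y ∧ 2 < dist x z ∧ 2 < dist y z))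
    (hvol : ENNReal.ofReal (2 * Real.pi) ≤ volume B) : ∃ x ∈ B, ∃ y ∈ B, 4 ≤ dist x y := by
  have hpi := Real.pi_pos
  have hne : B.Nonempty := by
    by_contra hn
    rw [Set.not_nonempty_iff_eq_empty.1 hn, measure_empty, nonpos_iff_eq_zero,
      ENNReal.ofReal_eq_zero] at hvol
    linarith
  obtain ⟨⟨x, y⟩, ⟨hx, hy⟩, hmax⟩ := (hB.prod hB).exists_isMaxOn (hne.prod hne)
    (continuous_dist (α := Plane)).continuousOn
  replace hmax : ∀ p ∈ B, ∀ q ∈ B, dist p q ≤ dist x y := fun p hp q hq =>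
    isMaxOn_iff.1 hmax (p, q) (Set.mk_mem_prod hp hq)
  refine ⟨x, hx, y, hy, ?_⟩
  by_contra h4
  rw [not_le] at h4
  have h8 : 8 ≤ dist x y ^ 2 := by
    by_contra hn
    refine (hvol.trans (volume_le_of_dist_le_of_isCompact hB dist_nonneg hmax)).not_gt
      ((ENNReal.ofReal_lt_ofReal_iff (by positivity)).2 ?_)
    nlinarith
  have h2 : 2 < dist x y := by nlinarith [dist_nonneg (x := x) (y := y)]
  have h1 := volume_far_lt (isCompact_farPart hB y) two_le_dist_of_mem_farPart h8 h4
    (fun p hp => hmax p (farPart_subset hB y hp) y hy) (dist_le_of_mem_farPart hy h)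
    (mem_farPart hx h2)
  have h3 : volume (farPart B x) <
      ENNReal.ofReal (2 * semichordIntegral 2 (dist x y / 2) - Real.pi) := by
    rw [dist_comm x y] at h8 h4 h2 hmax ⊢
    exact volume_far_lt (isCompact_farPart hB x) two_le_dist_of_mem_farPart h8 h4
      (fun p hp => hmax p (farPart_subset hB x hp) x hx) (dist_le_of_mem_farPart hx h)
      (mem_farPart hy h2)
  have h5 := volume_lens_le (by linarith) h4.le
  have hJ : Real.pi < 2 * semichordIntegral 2 (dist x y / 2) :=
    pi_lt_two_mul_semichordIntegral (by linarith) (by linarith)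
  have hJ' := semichordIntegral_le_self zero_le_two (dist x y / 2)
  have hsum := ENNReal.add_lt_add_of_lt_of_le
    (h5.trans_lt ENNReal.ofReal_lt_top).ne (ENNReal.add_lt_add h1 h3) h5
  rw [← ENNReal.ofReal_add (by linarith) (by linarith), ← ENNReal.ofReal_add (by linarith)
    (by linarith)] at hsum
  have hle : volume B ≤ volume (farPart B y) + volume (farPart B x) +
      volume {p | dist p x ≤ 2 ∧ dist p y ≤ 2} :=
    (measure_mono (subset_farPart_union B x y)).trans ((measure_union_le _ _).trans
      (add_le_add_left (measure_union_le _ _) _))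
  exact ((hvol.trans hle).trans_lt hsum).not_ge (ENNReal.ofReal_le_ofReal (by linarith))

theorem stmt5 (A : Set (EuclideanSpace ℝ (Fin 2))) (hA : MeasurableSet A)
    (hfree : ¬ ∃ x y z, x ∈ A ∧ y ∈ A ∧ z ∈ A ∧
      2 < dist x y ∧ 2 < dist x z ∧ 2 < dist y z)
    (heq : volume A = ENNReal.ofReal (2 * Real.pi)) :
    ∃ c₁ c₂ : EuclideanSpace ℝ (Fin 2),
      Disjoint (Metric.ball c₁ 1) (Metric.ball c₂ 1) ∧
      volume (symmDiff A (Metric.closedBall c₁ 1 ∪ Metric.closedBall c₂ 1)) = 0 := by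
  have hfree' : ∀ x ∈ A, ∀ y ∈ A, ∀ z ∈ A, ¬(2 < dist x y ∧ 2 < dist x z ∧ 2 < dist y z) :=
    fun x hx y hy z hz hn => hfree ⟨x, y, z, hx, hy, hz, hn⟩
  have hB := (isBounded_of_not_pairwise_far hfree').isCompact_closure
  have hBfree := not_pairwise_far_of_mem_closure hfree'
  obtain ⟨x, hx, y, hy, h4⟩ := exists_four_le_dist hB hBfree
    (heq.ge.trans (measure_mono subset_closure))
  have hlens : {p : Plane | dist p x ≤ 2 ∧ dist p y ≤ 2} ⊆ Metric.sphere x 2 := by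
    rintro p ⟨h1, h2⟩
    rw [Metric.mem_sphere]
    linarith [dist_triangle_left x y p]
  have hnull : volume {p : Plane | dist p x ≤ 2 ∧ dist p y ≤ 2} = 0 :=
    measure_mono_null hlens (Measure.addHaar_sphere _ _ _)
  set P := farPart (closure A) y
  set Q := farPart (closure A) x
  have hPd : ∀ p ∈ P, ∀ q ∈ P, dist p q ≤ 2 := dist_le_of_mem_farPart hy hBfree
  have hQd : ∀ p ∈ Q, ∀ q ∈ Q, dist p q ≤ 2 := dist_le_of_mem_farPart hx hBfree
  have hP : IsCompact P := isCompact_farPart hB y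
  have hQ : IsCompact Q := isCompact_farPart hB x
  have hAsub : A ⊆ P ∪ Q ∪ {p | dist p x ≤ 2 ∧ dist p y ≤ 2} :=
    subset_closure.trans (subset_farPart_union _ x y)
  have hpi := Real.pi_pos.le
  have hle : ENNReal.ofReal Real.pi + ENNReal.ofReal Real.pi ≤ volume P + volume Q := by
    rw [← ENNReal.ofReal_add hpi hpi, ← two_mul, ← heq]
    refine (measure_mono hAsub).trans ((measure_union_le _ _).trans ?_)
    rw [hnull, add_zero]
    exact measure_union_le _ _
  have hPle := volume_le_of_dist_le_of_isCompact hP zero_le_two hPd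
  have hQle := volume_le_of_dist_le_of_isCompact hQ zero_le_two hQd
  rw [show Real.pi * 2 ^ 2 / 4 = Real.pi by ring] at hPle hQle
  have hPge : ENNReal.ofReal Real.pi ≤ volume P := by
    by_contra hn
    exact hle.not_gt (ENNReal.add_lt_add_of_lt_of_le hQ.measure_lt_top.ne (not_le.1 hn) hQle)
  have hQge : ENNReal.ofReal Real.pi ≤ volume Q := by
    by_contra hn
    exact hle.not_gt (ENNReal.add_lt_add_of_le_of_lt hP.measure_lt_top.ne hPle (not_le.1 hn))
  obtain ⟨c₁, hc₁⟩ := ae_eq_closedBall_of_pi_le_volume hP hPd hPge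
  obtain ⟨c₂, hc₂⟩ := ae_eq_closedBall_of_pi_le_volume hQ hQd hQge
  have hsub : A ≤ᵐ[volume] (Metric.closedBall c₁ 1 ∪ Metric.closedBall c₂ 1 : Set Plane) := by
    refine (LE.le.eventuallyLE hAsub).trans ?_
    refine (union_ae_eq_left_of_ae_eq_empty (ae_eq_empty.2 hnull)).le.trans ?_
    exact (hc₁.union hc₂).le
  have hsum : volume (Metric.closedBall c₁ 1) + volume (Metric.closedBall c₂ 1) = volume A := by
    rw [volume_closedBall_one, volume_closedBall_one, heq, ← ENNReal.ofReal_add hpi hpi, ← two_mul]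
  have hA_top : volume A ≠ ⊤ := heq ▸ ENNReal.ofReal_ne_top
  have hunion : volume (Metric.closedBall c₁ 1 ∪ Metric.closedBall c₂ 1) ≤ volume A :=
    (measure_union_le _ _).trans hsum.le
  have hAeq := ae_eq_of_ae_subset_of_measure_ge hsub hunion hA.nullMeasurableSet
    (hunion.trans_lt hA_top.lt_top).ne
  refine ⟨c₁, c₂, ?_, measure_symmDiff_eq_zero_iff.2 hAeq⟩
  have hinter : volume (Metric.closedBall c₁ 1 ∩ Metric.closedBall c₂ 1) = 0 := by
    have h1 := measure_union_add_inter (μ := volume) (Metric.closedBall c₁ 1)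
      (Metric.isClosed_closedBall (x := c₂) (ε := 1)).measurableSet
    rw [← measure_congr hAeq, hsum] at h1
    exact (ENNReal.add_right_inj hA_top).1 (h1.trans (add_zero _).symm)
  exact Set.disjoint_iff_inter_eq_empty.2
    ((Metric.isOpen_ball.inter Metric.isOpen_ball).eq_empty_of_measure_zero
      (measure_mono_null (Set.inter_subset_inter Metric.ball_subset_closedBall
        Metric.ball_subset_closedBall) hinter))
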